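/- Subgradient inequality for the loss (eq. (34)). Let H be an N×d complex matrix, let φ : ℝ → ℝ be concave, nondecreasing and differentiable, and set ℓ(Q) = Re(tr Q) − φ(R_H(Q)) with R_H(Q) = log det(I + H·Q·H†). Fix a d×d complex Hermitian positive-semidefinite matrix Q₀ and let V = I − φ′(R_H(Q₀)) · H†·(I + H·Q₀·H†)^{-1}·H (a Hermitian matrix). Then for every d×d complex Hermitian positive-semidefinite matrix Q, ℓ(Q₀) − ℓ(Q) ≤ Re tr[(Q₀ − Q)·V]. -/

import Mathlib

open Matrix
open scoped BigOperators ComplexOrder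

noncomputable section

abbrev Mat (d : ℕ) := Matrix (Fin d) (Fin d) ℂ

/-- The real part of the trace of a complex matrix. -/
def trR {d : ℕ} (M : Mat d) : ℝ := (Matrix.trace M).re

/-- The Shannon rate `R_H(Q) = log det (I + H Q Hᴴ)`. -/
def rate {d N : ℕ} (H : Matrix (Fin N) (Fin d) ℂ) (Q : Mat d) : ℝ :=
  Real.log ((1 + H * Q * Hᴴ).det.re)

/-- The power/rate loss `ℓ(Q) = Re(tr Q) − φ(R_H(Q))`. -/
def loss {d N : ℕ} (H : Matrix (Fin N) (Fin d) ℂ) (φ : ℝ → ℝ) (Q : Mat d) : ℝ :=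
  trR Q - φ (rate H Q)

/-- The gradient matrix `V = I − φ'(R_H(Q)) Hᴴ (I + H Q Hᴴ)⁻¹ H`. -/
def gradV {d N : ℕ} (H : Matrix (Fin N) (Fin d) ℂ) (φ : ℝ → ℝ) (Q : Mat d) : Mat d :=
  1 - (↑(deriv φ (rate H Q)) : ℂ) • (Hᴴ * (1 + H * Q * Hᴴ)⁻¹ * H)

/-- The graph of a differentiable concave function lies below each of its tangent lines. -/
theorem ConcaveOn.le_add_deriv_mul_sub {f : ℝ → ℝ} (hf : ConcaveOn ℝ Set.univ f) {x : ℝ}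
    (hx : DifferentiableAt ℝ f x) (y : ℝ) : f y ≤ f x + deriv f x * (y - x) := by
  rcases lt_trichotomy x y with h | rfl | h
  · have := hf.slope_le_deriv trivial trivial h hx
    rw [slope_def_field, div_le_iff₀ (sub_pos.2 h)] at this
    linarith
  · simp
  · have := hf.deriv_le_slope trivial trivial h hx
    rw [slope_def_field, le_div_iff₀ (sub_pos.2 h)] at this
    linarith

namespace Matrix

variable {n : Type*} [Fintype n] [DecidableEq n]

theorem PosDef.log_det_le_trace_sub_card {M : Matrix n n ℂ} (hM : M.PosDef) :
    Real.log M.det.re ≤ M.trace.re - Fintype.card n := by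
  have hdet : M.det.re = ∏ i, hM.isHermitian.eigenvalues i := by
    rw [hM.isHermitian.det_eq_prod_eigenvalues]
    norm_cast
  have htr : M.trace.re = ∑ i, hM.isHermitian.eigenvalues i := by
    rw [hM.isHermitian.trace_eq_sum_eigenvalues]
    simp
  rw [hdet, htr, Real.log_prod fun i _ ↦ (hM.eigenvalues_pos i).ne']
  calc ∑ i, Real.log (hM.isHermitian.eigenvalues i)
      ≤ ∑ i, (hM.isHermitian.eigenvalues i - 1) :=
        Finset.sum_le_sum fun i _ ↦ Real.log_le_sub_one_of_pos (hM.eigenvalues_pos i)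
    _ = _ := by simp

open scoped MatrixOrder Matrix.Norms.L2Operator in
/-- Concavity of `log det` on positive definite matrices, as a tangent plane inequality. -/
theorem PosDef.log_det_sub_log_det_le {A B : Matrix n n ℂ} (hA : A.PosDef) (hB : B.PosDef) :
    Real.log B.det.re - Real.log A.det.re ≤ (((B - A) * A⁻¹).trace).re := by
  obtain ⟨C, hC⟩ : ∃ C : Matrix n n ℂ, A⁻¹ = C * Cᴴ := by
    obtain ⟨S, hS⟩ := CStarAlgebra.nonneg_iff_eq_star_mul_self.1 hA.inv.posSemidef.nonneg
    exact ⟨Sᴴ, by simpa [star_eq_conjTranspose] using hS⟩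
  have hAu : IsUnit A.det := (isUnit_iff_isUnit_det A).1 hA.isUnit
  have hCu : IsUnit C := by
    rw [isUnit_iff_isUnit_det, isUnit_iff_ne_zero]
    intro h
    have := hA.inv.det_pos
    simp [hC, h] at this
  have hM : (Cᴴ * B * C).PosDef :=
    hB.conjTranspose_mul_mul_same (mulVec_injective_of_isUnit hCu)
  have key := hM.log_det_le_trace_sub_card
  have hdet : A.det * (Cᴴ * B * C).det = B.det := by
    have h : A.det * (C.det * Cᴴ.det) = 1 := by
      rw [← det_mul C, ← hC, ← det_mul, mul_nonsing_inv A hAu, det_one]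
    rw [det_mul, det_mul]
    linear_combination B.det * h
  have htr : (Cᴴ * B * C).trace = (B * A⁻¹).trace := by
    rw [hC, trace_mul_cycle, trace_mul_comm]
  have hA0 := Complex.pos_iff.1 hA.det_pos
  have hM0 := Complex.pos_iff.1 hM.det_pos
  have hre : B.det.re = A.det.re * (Cᴴ * B * C).det.re := by
    rw [← hdet, Complex.mul_re, ← hA0.2]
    simp
  rw [hre, Real.log_mul hA0.1.ne' hM0.1.ne', sub_mul, mul_nonsing_inv A hAu, trace_sub,
    trace_one, ← htr]
  simpa using key

end Matrix

theorem posDef_one_add_mul_mul_conjTranspose {d N : ℕ} (H : Matrix (Fin N) (Fin d) ℂ) {Q : Mat d}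
    (hQ : Q.PosSemidef) : (1 + H * Q * Hᴴ).PosDef :=
  PosDef.one.add_posSemidef (hQ.mul_mul_conjTranspose_same H)

theorem rate_sub_rate_le {d N : ℕ} (H : Matrix (Fin N) (Fin d) ℂ) {Q₀ Q : Mat d}
    (hQ₀ : Q₀.PosSemidef) (hQ : Q.PosSemidef) :
    rate H Q - rate H Q₀ ≤
      (Matrix.trace ((Q - Q₀) * (Hᴴ * (1 + H * Q₀ * Hᴴ)⁻¹ * H))).re := by
  refine ((posDef_one_add_mul_mul_conjTranspose H hQ₀).log_det_sub_log_det_le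
    (posDef_one_add_mul_mul_conjTranspose H hQ)).trans_eq (congrArg Complex.re ?_)
  rw [add_sub_add_left_eq_sub, ← Matrix.sub_mul, ← Matrix.mul_sub, Matrix.mul_assoc,
    Matrix.mul_assoc, Matrix.trace_mul_comm]
  simp only [Matrix.mul_assoc]

/-- **Eq. (34)** (subgradient inequality for the loss): for concave, nondecreasing,
differentiable `φ`, `Q₀ ⪰ 0`, and `V = I − φ'(R_H(Q₀)) Hᴴ (I + H Q₀ Hᴴ)⁻¹ H`, one has
`ℓ(Q₀) − ℓ(Q) ≤ Re tr[(Q₀ − Q)V]` for all `Q ⪰ 0`. -/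
theorem loss_subgradient_inequality
    {d N : ℕ} (H : Matrix (Fin N) (Fin d) ℂ) (φ : ℝ → ℝ)
    (hφconc : ConcaveOn ℝ Set.univ φ) (hφmono : Monotone φ)
    (hφdiff : Differentiable ℝ φ)
    (Q₀ : Mat d) (hQ₀ : Q₀.PosSemidef) :
    ∀ Q : Mat d, Q.PosSemidef →
      loss H φ Q₀ - loss H φ Q ≤ (Matrix.trace ((Q₀ - Q) * gradV H φ Q₀)).re := by
  intro Q hQ
  have htan := hφconc.le_add_deriv_mul_sub (hφdiff (rate H Q₀)) (rate H Q)
  have hrate := mul_le_mul_of_nonneg_left (rate_sub_rate_le H hQ₀ hQ)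
    (hφmono.deriv_nonneg (x := rate H Q₀))
  have htrace : (Matrix.trace ((Q₀ - Q) * gradV H φ Q₀)).re = trR Q₀ - trR Q +
      deriv φ (rate H Q₀) *
        (Matrix.trace ((Q - Q₀) * (Hᴴ * (1 + H * Q₀ * Hᴴ)⁻¹ * H))).re := by
    rw [gradV, Matrix.mul_sub, Matrix.mul_one, Matrix.mul_smul, Matrix.trace_sub,
      Matrix.trace_smul, ← neg_sub Q Q₀, Matrix.neg_mul, Matrix.trace_neg, Matrix.trace_neg,
      Matrix.trace_sub, trR, trR]
    simp only [smul_eq_mul, mul_neg, sub_neg_eq_add, Complex.add_re, Complex.neg_re,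
      Complex.sub_re, Complex.re_ofReal_mul]
    ring
  rw [htrace, loss, loss]
  linarith
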